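/- Every element of the kernel of f₁ lies in the image of f₂; that is, ker f₁ = im f₂ as subspaces of W ⊗ V₂ (equivalently, the Koszul cohomology group K_{1,2} of the genus-g balanced ribbon vanishes). -/

import Mathlib

set_option synthInstance.maxHeartbeats 400000
set_option maxHeartbeats 1000000

noncomputable section

open scoped TensorProduct

/-- The coordinate ring `A = ℂ[u,ε]/(ε²)` of the chart `U` of the balanced ribbon. -/
def A : Type := DualNumber (Polynomial ℂ)

instance : CommRing A := inferInstanceAs (CommRing (DualNumber (Polynomial ℂ)))
instance : Algebra ℂ A := inferInstanceAs (Algebra ℂ (DualNumber (Polynomial ℂ)))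

def uu : A := TrivSqZeroExt.inl Polynomial.X
def ee : A := DualNumber.eps

/-- The restrictions to `U` of the standard basis of `H⁰(ω)` of the balanced ribbon. -/
def x (k i : ℕ) : A :=
  if i ≤ k then uu ^ i else uu ^ i + ((i - k : ℕ) : A) * uu ^ (i - k - 1) * ee

/-- `V_m`: the span of the degree-`m` monomials in `x_0, …, x_{2k}`. -/
def V (k m : ℕ) : Submodule ℂ A :=
  Submodule.span ℂ {a | ∃ f : Fin m → ℕ, (∀ j, f j ≤ 2 * k) ∧ a = ∏ j, x k (f j)}

/-- `W = span ℂ {x_0, …, x_{2k}}`. -/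
def W (k : ℕ) : Submodule ℂ A := Submodule.span ℂ (x k '' Set.Iic (2 * k))

def xW (k i : ℕ) : ↥(W k) :=
  if h : i ≤ 2 * k then ⟨x k i, Submodule.subset_span ⟨i, h, rfl⟩⟩ else 0

def xV2 (k i j : ℕ) : ↥(V k 2) :=
  if h : i ≤ 2 * k ∧ j ≤ 2 * k then
    ⟨x k i * x k j, Submodule.subset_span ⟨![i, j], by
      refine ⟨?_, ?_⟩
      · intro t
        fin_cases t
        · simpa using h.1
        · simpa using h.2
      · simp [Fin.prod_univ_two]⟩⟩
  else 0

/-- The Koszul differential `f₁ : W ⊗ V₂ → V₃ ⊆ A`, `x ⊗ q ↦ x·q`. -/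
def f1 (k : ℕ) : (↥(W k) ⊗[ℂ] ↥(V k 2)) →ₗ[ℂ] A :=
  TensorProduct.lift (((LinearMap.mul ℂ A).comp (W k).subtype).compl₂ (V k 2).subtype)

/-- The image under the Koszul differential `f₂` of the cosyzygy `(x_a ∧ x_b) ⊗ x_c`,
namely `x_b ⊗ x_a x_c − x_a ⊗ x_b x_c ∈ W ⊗ V₂`. -/
def cosz (k a b c : ℕ) : ↥(W k) ⊗[ℂ] ↥(V k 2) :=
  xW k b ⊗ₜ[ℂ] xV2 k a c - xW k a ⊗ₜ[ℂ] xV2 k b c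

/-- A finite set `S` of triples is a monomial basis of cosyzygies if the family
`f₂((x_a ∧ x_b) ⊗ x_c) = x_b ⊗ x_a x_c − x_a ⊗ x_b x_c`, `(a,b,c) ∈ S`,
is a basis of `ker f₁`. -/
def IsMonomialBasisOfCosyzygies (k : ℕ) (S : Finset (ℕ × ℕ × ℕ)) : Prop :=
  LinearIndependent ℂ (fun t : S => cosz k t.1.1 t.1.2.1 t.1.2.2) ∧
  Submodule.span ℂ ((fun t : ℕ × ℕ × ℕ => cosz k t.1 t.2.1 t.2.2) '' ↑S) =
    LinearMap.ker (f1 k)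

/-- The number of occurrences of the index `i` among the entries of the triples of `S`. -/
def occ (S : Finset (ℕ × ℕ × ℕ)) (i : ℕ) : ℕ :=
  ∑ t ∈ S, ((if t.1 = i then 1 else 0) + (if t.2.1 = i then 1 else 0) +
    (if t.2.2 = i then 1 else 0))

/-- The element `u^n + c u^(n-k-1) ε` of `A`. -/
def ribbonMonomial (k n c : ℕ) : A := uu ^ n + (c : A) * (uu ^ (n - k - 1) * ee)

lemma ee_mul_ee : ee * ee = 0 := DualNumber.eps_mul_eps (R := Polynomial ℂ)

lemma x_eq_ribbonMonomial (k i : ℕ) : x k i = ribbonMonomial k i (i - k) := by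
  unfold x ribbonMonomial
  split_ifs with h
  · simp [Nat.sub_eq_zero_of_le h]
  · ring

lemma ribbonMonomial_mul {k n m c d : ℕ} (hc : c = 0 ∨ k + 1 ≤ n) (hd : d = 0 ∨ k + 1 ≤ m) :
    ribbonMonomial k n c * ribbonMonomial k m d = ribbonMonomial k (n + m) (c + d) := by
  have h1 : (c : A) * uu ^ (n - k - 1) * uu ^ m = c * uu ^ (n + m - k - 1) := by
    rcases hc with rfl | h
    · simp
    · rw [mul_assoc, ← pow_add]; congr 2; omega
  have h2 : (d : A) * uu ^ (m - k - 1) * uu ^ n = d * uu ^ (n + m - k - 1) := by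
    rcases hd with rfl | h
    · simp
    · rw [mul_assoc, ← pow_add]; congr 2; omega
  unfold ribbonMonomial
  push_cast
  linear_combination ee * h1 + ee * h2 +
    (c : A) * d * uu ^ (n - k - 1) * uu ^ (m - k - 1) * ee_mul_ee

lemma x_mul_x (k i j : ℕ) :
    x k i * x k j = ribbonMonomial k (i + j) ((i - k) + (j - k)) := by
  rw [x_eq_ribbonMonomial, x_eq_ribbonMonomial, ribbonMonomial_mul (by omega) (by omega)]

lemma x_mul_x_mul_x (k a b c : ℕ) :
    x k a * (x k b * x k c) =
      ribbonMonomial k (a + (b + c)) ((a - k) + ((b - k) + (c - k))) := by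
  rw [x_mul_x, x_eq_ribbonMonomial, ribbonMonomial_mul (by omega) (by omega)]

/-- The linear map on `A` sending `u^n` to `α n` and `u^(n-k-1) ε` to `β n`. -/
def liftA {Q : Type*} [AddCommGroup Q] [Module ℂ Q] (k : ℕ) (α β : ℕ → Q) : A →ₗ[ℂ] Q :=
  ((Polynomial.basisMonomials ℂ).constr ℂ α).comp
      (TrivSqZeroExt.fstHom ℂ (Polynomial ℂ) (Polynomial ℂ)).toLinearMap +
    ((Polynomial.basisMonomials ℂ).constr ℂ fun j => β (j + k + 1)).comp
      (TrivSqZeroExt.sndHom (Polynomial ℂ) (Polynomial ℂ) |>.restrictScalars ℂ)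

lemma uu_pow_eq (n : ℕ) :
    uu ^ n = (TrivSqZeroExt.inl (Polynomial.X ^ n) : DualNumber (Polynomial ℂ)) := by
  induction n with
  | zero => rfl
  | succ n ih =>
    rw [pow_succ, ih, pow_succ]
    exact (TrivSqZeroExt.inl_mul (M := Polynomial ℂ) _ _).symm

lemma uu_pow_mul_ee_eq (n : ℕ) :
    uu ^ n * ee = (TrivSqZeroExt.inr (Polynomial.X ^ n) : DualNumber (Polynomial ℂ)) := by
  rw [uu_pow_eq]
  refine (TrivSqZeroExt.inl_mul_inr (Polynomial.X ^ n : Polynomial ℂ) (1 : Polynomial ℂ)).trans ?_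
  simp

section
variable {Q : Type*} [AddCommGroup Q] [Module ℂ Q]

lemma constr_basisMonomials_X_pow (α : ℕ → Q) (n : ℕ) :
    (Polynomial.basisMonomials ℂ).constr ℂ α (Polynomial.X ^ n) = α n := by
  have := (Polynomial.basisMonomials ℂ).constr_basis ℂ α n
  simpa only [Polynomial.coe_basisMonomials, Polynomial.monomial_one_right_eq_X_pow] using this

lemma liftA_uu_pow (k : ℕ) (α β : ℕ → Q) (n : ℕ) : liftA k α β (uu ^ n) = α n := by
  rw [uu_pow_eq]
  refine Eq.trans (b := (Polynomial.basisMonomials ℂ).constr ℂ α (Polynomial.X ^ n) +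
    (Polynomial.basisMonomials ℂ).constr ℂ (fun j => β (j + k + 1)) 0) rfl ?_
  rw [map_zero, add_zero, constr_basisMonomials_X_pow]

lemma liftA_uu_pow_mul_ee (k : ℕ) (α β : ℕ → Q) (n : ℕ) :
    liftA k α β (uu ^ n * ee) = β (n + k + 1) := by
  rw [uu_pow_mul_ee_eq]
  refine Eq.trans (b := (Polynomial.basisMonomials ℂ).constr ℂ α 0 +
    (Polynomial.basisMonomials ℂ).constr ℂ (fun j => β (j + k + 1)) (Polynomial.X ^ n)) rfl ?_
  rw [map_zero, zero_add, constr_basisMonomials_X_pow]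

lemma liftA_ribbonMonomial (k : ℕ) (α β : ℕ → Q) {n c : ℕ} (h : c = 0 ∨ k + 1 ≤ n) :
    liftA k α β (ribbonMonomial k n c) = α n + (c : ℂ) • β n := by
  unfold ribbonMonomial
  rw [← nsmul_eq_mul, map_add, map_nsmul, liftA_uu_pow, liftA_uu_pow_mul_ee, Nat.cast_smul_eq_nsmul]
  rcases h with rfl | h
  · simp
  · rw [show n - k - 1 + k + 1 = n by omega]

/-- A function of three indices in `[0, 2k]` that is symmetric and, for each fixed first index `a`
and each fixed sum `m` of the other two, affine in `(b - k)⁺ + (c - k)⁺` with slope `B a m`. -/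
structure PairwiseAffine (k : ℕ) (F : ℕ → ℕ → ℕ → Q) (B : ℕ → ℕ → Q) : Prop where
  swap_right : ∀ {a b c}, a ≤ 2 * k → b ≤ 2 * k → c ≤ 2 * k → F a b c = F a c b
  swap_left : ∀ {a b c}, a ≤ 2 * k → b ≤ 2 * k → c ≤ 2 * k → F a b c = F b a c
  affine : ∀ {a b c b' c'}, a ≤ 2 * k → b ≤ 2 * k → c ≤ 2 * k → b' ≤ 2 * k → c' ≤ 2 * k →
    b + c = b' + c' →
    F a b c - F a b' c' =
      ((((b - k) + (c - k) : ℕ) : ℂ) - (((b' - k) + (c' - k) : ℕ) : ℂ)) • B a (b + c)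

namespace PairwiseAffine

variable {k : ℕ} {F : ℕ → ℕ → ℕ → Q} {B : ℕ → ℕ → Q}

lemma eq_of_eq (h : PairwiseAffine k F B) {a b c b' c' : ℕ} (ha : a ≤ 2 * k) (hb : b ≤ 2 * k)
    (hc : c ≤ 2 * k) (hb' : b' ≤ 2 * k) (hc' : c' ≤ 2 * k) (hs : b + c = b' + c')
    (he : (b - k) + (c - k) = (b' - k) + (c' - k)) : F a b c = F a b' c' := by
  have := h.affine ha hb hc hb' hc' hs
  rwa [he, sub_self, zero_smul, sub_eq_zero] at this

lemma inward (h : PairwiseAffine k F B) {a b c : ℕ} (ha : a ≤ 2 * k) (hb : b < k) (hc : k ≤ c)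
    (hc' : c + 1 ≤ 2 * k) : F a b (c + 1) - F a (b + 1) c = B a (b + c + 1) := by
  have := h.affine (a := a) (b := b) (c := c + 1) (b' := b + 1) (c' := c) ha (by omega) hc'
    (by omega) (by omega) (by omega)
  rw [this, show (b - k) + (c + 1 - k) = (b + 1 - k) + (c - k) + 1 by omega]
  push_cast
  simp [add_assoc]

lemma slope_low_low (h : PairwiseAffine k F B) {a b c : ℕ} (ha : a < k) (hb : b < k) (hc : k ≤ c)
    (hc' : c + 1 ≤ 2 * k) : B a (b + c + 1) = B b (a + c + 1) := by
  rw [← h.inward (by omega) hb hc hc', ← h.inward (by omega) ha hc hc']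
  rw [h.swap_left (a := a) (b := b) (c := c + 1) (by omega) (by omega) (by omega)]
  congr 1
  rw [h.swap_right (a := a) (by omega) (by omega) (by omega),
    h.swap_right (a := b) (by omega) (by omega) (by omega),
    h.swap_left (a := a) (by omega) (by omega) (by omega),
    h.swap_left (a := b) (by omega) (by omega) (by omega)]
  exact h.eq_of_eq (by omega) (by omega) (by omega) (by omega) (by omega) (by omega) (by omega)

lemma slope_high_high (h : PairwiseAffine k F B) {a b c : ℕ} (ha : a < k) (hb : k ≤ b)
    (hb' : b + 1 ≤ 2 * k) (hc : k ≤ c) (hc' : c + 1 ≤ 2 * k) :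
    B (b + 1) (a + c + 1) = B (c + 1) (a + b + 1) := by
  rw [← h.inward (by omega) ha hc hc', ← h.inward (by omega) ha hb hb']
  congr 1
  · rw [h.swap_left (a := b + 1) (by omega) (by omega) (by omega),
      h.swap_right (a := a) (by omega) (by omega) (by omega),
      h.swap_left (a := a) (by omega) (by omega) (by omega)]
  · rw [h.swap_left (a := b + 1) (by omega) (by omega) (by omega),
      h.swap_left (a := c + 1) (by omega) (by omega) (by omega)]
    exact h.eq_of_eq (by omega) (by omega) (by omega) (by omega) (by omega) (by omega) (by omega)

lemma slope_mid_low (h : PairwiseAffine k F B) {a c : ℕ} (ha : a < k) (hc : k ≤ c)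
    (hc' : c + 1 ≤ 2 * k) : B k (a + c + 1) = B (a + 1) (k + c) := by
  have h1 := h.inward (a := k) (by omega) ha hc hc'
  have h2 := h.inward (a := a + 1) (b := k - 1) (by omega) (by omega) hc hc'
  rw [show k - 1 + c + 1 = k + c by omega, show k - 1 + 1 = k by omega] at h2
  rw [← h1, ← h2]
  congr 1
  · rw [h.swap_right (a := k) (by omega) (by omega) (by omega),
      h.swap_left (a := k) (by omega) (by omega) (by omega),
      h.swap_right (a := a + 1) (by omega) (by omega) (by omega),
      h.swap_left (a := a + 1) (by omega) (by omega) (by omega)]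
    exact h.eq_of_eq (by omega) (by omega) (by omega) (by omega) (by omega) (by omega) (by omega)
  · exact h.swap_left (by omega) (by omega) (by omega)

lemma slope_mid_high (h : PairwiseAffine k F B) {a c : ℕ} (ha : a < k) (hc : k ≤ c)
    (hc' : c + 1 ≤ 2 * k) : B k (a + c + 1) = B c (a + k + 1) := by
  have h1 := h.inward (a := k) (by omega) ha hc hc'
  have h2 := h.inward (a := c) (b := a) (c := k) (by omega) ha le_rfl (by omega)
  rw [← h1, ← h2]
  congr 1
  · rw [h.swap_left (a := k) (by omega) (by omega) (by omega),
      h.swap_left (a := c) (by omega) (by omega) (by omega)]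
    exact h.eq_of_eq (by omega) (by omega) (by omega) (by omega) (by omega) (by omega) (by omega)
  · rw [h.swap_right (a := k) (by omega) (by omega) (by omega),
      h.swap_left (a := k) (by omega) (by omega) (by omega),
      h.swap_right (a := c) (by omega) (by omega) (by omega)]

/-- The slope depends only on the sum of the three indices. -/
lemma exists_slope (h : PairwiseAffine k F B) (n : ℕ) :
    ∃ β : Q, ∀ a m, a ≤ 2 * k → a + m = n → k + 1 ≤ m → m + 1 ≤ 3 * k → B a m = β := by
  rcases le_or_gt n (2 * k) with hn | hn
  · refine ⟨B 0 n, fun a m ha hm h1 h2 => ?_⟩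
    have := h.slope_low_low (a := a) (b := 0) (c := m - 1) (by omega) (by omega) (by omega)
      (by omega)
    rwa [show 0 + (m - 1) + 1 = m by omega, show a + (m - 1) + 1 = n by omega] at this
  rcases le_or_gt (4 * k) n with hn' | hn'
  · refine ⟨B (2 * k) (n - 2 * k), fun a m ha hm h1 h2 => ?_⟩
    have := h.slope_high_high (a := n - 2 * k - a) (b := a - 1) (c := 2 * k - 1) (by omega)
      (by omega) (by omega) (by omega) (by omega)
    rwa [show a - 1 + 1 = a by omega, show 2 * k - 1 + 1 = 2 * k by omega,
      show n - 2 * k - a + (2 * k - 1) + 1 = m by omega,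
      show n - 2 * k - a + (a - 1) + 1 = n - 2 * k by omega] at this
  refine ⟨B k (n - k), fun a m ha hm h1 h2 => ?_⟩
  -- the two ranges of first indices directly comparable with `k`
  have low : ∀ a m, a + m = n → 1 ≤ a → a ≤ k → 2 * k ≤ m → m + 1 ≤ 3 * k →
      B a m = B k (n - k) := by
    intro a m hm ha ha' h1 h2
    have := h.slope_mid_low (a := a - 1) (c := m - k) (by omega) (by omega) (by omega)
    rw [show a - 1 + (m - k) + 1 = n - k by omega, show a - 1 + 1 = a by omega,
      show k + (m - k) = m by omega] at this
    exact this.symm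
  have high : ∀ a m, a + m = n → k ≤ a → a + 1 ≤ 2 * k → k + 1 ≤ m → m ≤ 2 * k →
      B a m = B k (n - k) := by
    intro a m hm ha ha' h1 h2
    have := h.slope_mid_high (a := m - k - 1) (c := a) (by omega) (by omega) (by omega)
    rw [show m - k - 1 + a + 1 = n - k by omega, show m - k - 1 + k + 1 = m by omega] at this
    exact this.symm
  have low_low : ∀ a m b m', a + m = n → b + m' = n → a < k → b < k → k + 1 + a + b ≤ n →
      n ≤ 2 * k + a + b → B a m = B b m' := by
    intro a m b m' hm hm' ha hb h1 h2
    have := h.slope_low_low (a := a) (b := b) (c := n - a - b - 1) (by omega) (by omega) (by omega)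
      (by omega)
    rwa [show b + (n - a - b - 1) + 1 = m by omega,
      show a + (n - a - b - 1) + 1 = m' by omega] at this
  have high_high : ∀ a m b m', a + m = n → b + m' = n → k < a → k < b → a ≤ 2 * k → b ≤ 2 * k →
      a + b ≤ n → n + 1 ≤ k + a + b → B a m = B b m' := by
    intro a m b m' hm hm' ha hb ha' hb' h1 h2
    have := h.slope_high_high (a := n - a - b) (b := a - 1) (c := b - 1) (by omega) (by omega)
      (by omega) (by omega) (by omega)
    rwa [show a - 1 + 1 = a by omega, show b - 1 + 1 = b by omega,
      show n - a - b + (b - 1) + 1 = m by omega,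
      show n - a - b + (a - 1) + 1 = m' by omega] at this
  have zero : n < 3 * k → B 0 n = B k (n - k) := fun hlt =>
    (low_low 0 n (n - 2 * k) (2 * k) (by omega) (by omega) (by omega) (by omega) (by omega)
      (by omega)).trans
      (low _ _ (by omega) (by omega) (by omega) (by omega) (by omega))
  have top : 3 * k < n → B (2 * k) (n - 2 * k) = B k (n - k) := fun hlt =>
    (high_high (2 * k) (n - 2 * k) (n - 2 * k) (2 * k) (by omega) (by omega) (by omega) (by omega)
      (by omega) (by omega) (by omega) (by omega)).trans
      (high _ _ (by omega) (by omega) (by omega) (by omega) (by omega))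
  rcases le_or_gt a k with hak | hak
  · rcases le_or_gt (2 * k) m with hmk | hmk
    · rcases Nat.eq_zero_or_pos a with rfl | hpos
      · obtain rfl : m = n := by omega
        exact zero (by omega)
      · exact low a m hm hpos hak hmk h2
    · rcases eq_or_lt_of_le hak with rfl | hak
      · rw [← hm, Nat.add_sub_cancel_left]
      · exact (low_low a m 0 n hm (by omega) hak (by omega) (by omega) (by omega)).trans
          (zero (by omega))
  · rcases le_or_gt m (2 * k) with hmk | hmk
    · rcases eq_or_lt_of_le ha with rfl | ha'
      · obtain rfl : m = n - 2 * k := by omega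
        exact top (by omega)
      · exact high a m hm hak.le ha' h1 hmk
    · exact (high_high a m (2 * k) (n - 2 * k) hm (by omega) hak (by omega) ha le_rfl (by omega)
        (by omega)).trans (top (by omega))

end PairwiseAffine

/-- A function of triples that is invariant under swaps and under moves fixing the first index
depends only on the sum of the triple. -/
lemma eq_of_sum_eq {T : Type*} {N : ℕ} {G : ℕ → ℕ → ℕ → T}
    (swap : ∀ {a b c}, a ≤ N → b ≤ N → c ≤ N → G a b c = G b a c)
    (move : ∀ {a b c b' c'}, a ≤ N → b ≤ N → c ≤ N → b' ≤ N → c' ≤ N → b + c = b' + c' →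
      G a b c = G a b' c') {a b c a' b' c' : ℕ} (ha : a ≤ N) (hb : b ≤ N) (hc : c ≤ N)
    (ha' : a' ≤ N) (hb' : b' ≤ N) (hc' : c' ≤ N) (hs : a + b + c = a' + b' + c') :
    G a b c = G a' b' c' := by
  have key : ∀ d a b c b' c', a + d ≤ N → b ≤ N → c ≤ N → b' ≤ N → c' ≤ N →
      a + b + c = a + d + b' + c' → G a b c = G (a + d) b' c' := by
    intro d
    induction d with
    | zero => intro a b c b' c' ha hb hc hb' hc' hs; exact move ha hb hc hb' hc' (by omega)
    | succ d ih =>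
      intro a b c b' c' ha hb hc hb' hc' hs
      -- arrange that the second index is positive, then shift one unit to the first
      obtain ⟨e, f, he, hf, hef⟩ : ∃ e f, e + 1 ≤ N ∧ f ≤ N ∧ e + 1 + f = b + c := by
        rcases Nat.eq_zero_or_pos b with rfl | hpos
        · exact ⟨c - 1, 0, by omega, by omega, by omega⟩
        · exact ⟨b - 1, c, by omega, by omega, by omega⟩
      calc G a b c = G a f (e + 1) := move (by omega) hb hc hf he (by omega)
        _ = G f a (e + 1) := swap (by omega) hf he
        _ = G f (a + 1) e := move hf (by omega) he (by omega) (by omega) (by omega)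
        _ = G (a + 1) f e := swap hf (by omega) (by omega)
        _ = G (a + 1 + d) b' c' := ih (a + 1) f e b' c' (by omega) hf (by omega) hb' hc' (by omega)
        _ = G (a + (d + 1)) b' c' := by rw [show a + 1 + d = a + (d + 1) by omega]
  rcases le_total a a' with h | h
  · obtain ⟨d, rfl⟩ := Nat.exists_eq_add_of_le h
    exact key d a b c b' c' ha' hb hc hb' hc' hs
  · obtain ⟨d, rfl⟩ := Nat.exists_eq_add_of_le h
    exact (key d a' b' c' b c ha hb' hc' hb hc hs.symm).symm

theorem PairwiseAffine.exists_affine {k : ℕ} {F : ℕ → ℕ → ℕ → Q} {B : ℕ → ℕ → Q}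
    (h : PairwiseAffine k F B) :
    ∃ α β : ℕ → Q, ∀ a b c, a ≤ 2 * k → b ≤ 2 * k → c ≤ 2 * k →
      F a b c = α (a + (b + c)) +
        (((a - k) + ((b - k) + (c - k)) : ℕ) : ℂ) • β (a + (b + c)) := by
  choose β hβ using h.exists_slope
  let G : ℕ → ℕ → ℕ → Q := fun a b c =>
    F a b c - (((a - k) + ((b - k) + (c - k)) : ℕ) : ℂ) • β (a + (b + c))
  have swap : ∀ {a b c}, a ≤ 2 * k → b ≤ 2 * k → c ≤ 2 * k → G a b c = G b a c := by
    intro a b c ha hb hc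
    simp only [G]
    rw [h.swap_left ha hb hc, add_left_comm a b c, add_left_comm (a - k)]
  have move : ∀ {a b c b' c'}, a ≤ 2 * k → b ≤ 2 * k → c ≤ 2 * k → b' ≤ 2 * k → c' ≤ 2 * k →
      b + c = b' + c' → G a b c = G a b' c' := by
    intro a b c b' c' ha hb hc hb' hc' hs
    simp only [G]
    rw [sub_eq_sub_iff_sub_eq_sub, ← hs, ← sub_smul]
    by_cases hv : k + 1 ≤ b + c ∧ b + c + 1 ≤ 3 * k
    · rw [h.affine ha hb hc hb' hc' hs, hβ (a + (b + c)) a (b + c) ha rfl hv.1 hv.2]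
      congr 1
      push_cast
      ring
    · have he : (b - k) + (c - k) = (b' - k) + (c' - k) := by omega
      rw [h.eq_of_eq ha hb hc hb' hc' hs he, he, sub_self, sub_self, zero_smul]
  have hG : ∀ n, ∃ α : Q, ∀ a b c, a ≤ 2 * k → b ≤ 2 * k → c ≤ 2 * k → a + (b + c) = n →
      G a b c = α := by
    intro n
    by_cases hn : ∃ a b c, a ≤ 2 * k ∧ b ≤ 2 * k ∧ c ≤ 2 * k ∧ a + (b + c) = n
    · obtain ⟨a', b', c', ha', hb', hc', hs'⟩ := hn
      exact ⟨G a' b' c', fun a b c ha hb hc hs =>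
        eq_of_sum_eq swap move ha hb hc ha' hb' hc' (by omega)⟩
    · exact ⟨0, fun a b c ha hb hc hs => (hn ⟨a, b, c, ha, hb, hc, hs⟩).elim⟩
  choose α hα using hG
  exact ⟨α, β, fun a b c ha hb hc => sub_eq_iff_eq_add.mp (hα _ a b c ha hb hc rfl)⟩

end

lemma coe_xW {k i : ℕ} (hi : i ≤ 2 * k) : (xW k i : A) = x k i := by
  simp [xW, hi]

lemma coe_xV2 {k i j : ℕ} (hi : i ≤ 2 * k) (hj : j ≤ 2 * k) :
    (xV2 k i j : A) = x k i * x k j := by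
  simp [xV2, hi, hj]

open Classical in
/-- The element `u^(m-k-1) ε` as an element of `V₂`, when it lies there, and `0` otherwise. -/
def epsV2 (k m : ℕ) : ↥(V k 2) :=
  if h : uu ^ (m - k - 1) * ee ∈ V k 2 then ⟨_, h⟩ else 0

lemma xV2_sub_xV2 {k b c b' c' : ℕ} (hb : b ≤ 2 * k) (hc : c ≤ 2 * k) (hb' : b' ≤ 2 * k)
    (hc' : c' ≤ 2 * k) (hs : b + c = b' + c') :
    xV2 k b c - xV2 k b' c' =
      ((((b - k) + (c - k) : ℕ) : ℂ) - (((b' - k) + (c' - k) : ℕ) : ℂ)) • epsV2 k (b + c) := by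
  set r : ℂ := (((b - k) + (c - k) : ℕ) : ℂ) - (((b' - k) + (c' - k) : ℕ) : ℂ) with hr
  have hA : ((xV2 k b c - xV2 k b' c' : ↥(V k 2)) : A) = r • (uu ^ (b + c - k - 1) * ee) := by
    rw [Submodule.coe_sub, coe_xV2 hb hc, coe_xV2 hb' hc', x_mul_x, x_mul_x, ← hs, hr, sub_smul,
      Nat.cast_smul_eq_nsmul, Nat.cast_smul_eq_nsmul, nsmul_eq_mul, nsmul_eq_mul]
    unfold ribbonMonomial
    ring
  apply Subtype.ext
  rw [hA, Submodule.coe_smul]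
  by_cases hm : uu ^ (b + c - k - 1) * ee ∈ V k 2
  · rw [epsV2, dif_pos hm]
  · have h0 : r = 0 := by
      by_contra h0
      refine hm ?_
      rw [← (V k 2).smul_mem_iff h0, ← hA]
      exact Subtype.property _
    rw [h0, zero_smul, zero_smul]

lemma f1_tmul (k : ℕ) (w : ↥(W k)) (q : ↥(V k 2)) : f1 k (w ⊗ₜ[ℂ] q) = (w : A) * (q : A) := rfl

lemma exists_linearMap_ker_eq {M N : Type} [AddCommGroup M] [AddCommGroup N] [Module ℂ M]
    [Module ℂ N] (S : Submodule ℂ (M ⊗[ℂ] N)) :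
    ∃ (Q : Type) (_ : AddCommGroup Q) (_ : Module ℂ Q) (π : M ⊗[ℂ] N →ₗ[ℂ] Q),
      LinearMap.ker π = S :=
  ⟨(M ⊗[ℂ] N) ⧸ S, inferInstance, inferInstance, S.mkQ, S.ker_mkQ⟩

/-- Linear maps out of `W ⊗ V₂` agree once they agree on the products of basis elements. -/
lemma tensor_hom_ext {k : ℕ} {Q : Type*} [AddCommGroup Q] [Module ℂ Q]
    {f g : (↥(W k) ⊗[ℂ] ↥(V k 2)) →ₗ[ℂ] Q}
    (h : ∀ a b c, a ≤ 2 * k → b ≤ 2 * k → c ≤ 2 * k →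
      f (xW k a ⊗ₜ[ℂ] xV2 k b c) = g (xW k a ⊗ₜ[ℂ] xV2 k b c)) : f = g := by
  refine TensorProduct.ext' fun w q => ?_
  obtain ⟨w, hw⟩ := w
  obtain ⟨q, hq⟩ := q
  induction hw using Submodule.span_induction with
  | zero =>
    rw [show (⟨0, Submodule.zero_mem _⟩ : ↥(W k)) = 0 from rfl, TensorProduct.zero_tmul, map_zero,
      map_zero]
  | add y z hy hz ihy ihz =>
    rw [show (⟨y + z, Submodule.add_mem _ hy hz⟩ : ↥(W k)) = ⟨y, hy⟩ + ⟨z, hz⟩ from rfl,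
      TensorProduct.add_tmul, map_add, map_add, ihy, ihz]
  | smul r y hy ih =>
    rw [show (⟨r • y, Submodule.smul_mem _ r hy⟩ : ↥(W k)) = r • ⟨y, hy⟩ from rfl,
      ← TensorProduct.smul_tmul', map_smul, map_smul, ih]
  | mem y hy =>
    obtain ⟨a, ha, rfl⟩ := hy
    induction hq using Submodule.span_induction with
    | zero =>
      rw [show (⟨0, Submodule.zero_mem _⟩ : ↥(V k 2)) = 0 from rfl, TensorProduct.tmul_zero,
        map_zero, map_zero]
    | add y z hy hz ihy ihz =>
      rw [show (⟨y + z, Submodule.add_mem _ hy hz⟩ : ↥(V k 2)) = ⟨y, hy⟩ + ⟨z, hz⟩ from rfl,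
        TensorProduct.tmul_add, map_add, map_add, ihy, ihz]
    | smul r y hy ih =>
      rw [show (⟨r • y, Submodule.smul_mem _ r hy⟩ : ↥(V k 2)) = r • ⟨y, hy⟩ from rfl,
        TensorProduct.tmul_smul, map_smul, map_smul, ih]
    | mem y hy =>
      obtain ⟨p, hp, rfl⟩ := hy
      have hw : (⟨x k a, Submodule.subset_span ⟨a, ha, rfl⟩⟩ : ↥(W k)) = xW k a :=
        Subtype.ext (coe_xW ha).symm
      have hmem : ∏ j, x k (p j) ∈ V k 2 := Submodule.subset_span ⟨p, hp, rfl⟩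
      have hq : (⟨∏ j, x k (p j), hmem⟩ : ↥(V k 2)) =
          xV2 k (p 0) (p 1) := by
        apply Subtype.ext
        rw [coe_xV2 (hp 0) (hp 1), Subtype.coe_mk, Fin.prod_univ_two]
      rw [hw, hq]
      exact h a (p 0) (p 1) ha (hp 0) (hp 1)

/-- `K_{1,2}(R) = 0` for the balanced ribbon: the kernel of the Koszul differential
`f₁ : W ⊗ V₂ → V₃` equals the image of `f₂ : (⋀²W) ⊗ W → W ⊗ V₂`, i.e. the span of the
elements `f₂((x_a ∧ x_b) ⊗ x_c) = x_b ⊗ x_a x_c − x_a ⊗ x_b x_c`. -/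
theorem stmt_8 (k : ℕ) (hk : 2 ≤ k) :
    LinearMap.ker (f1 k) =
      Submodule.span ℂ
        {v : ↥(W k) ⊗[ℂ] ↥(V k 2) |
          ∃ a b c : ℕ, a ≤ 2 * k ∧ b ≤ 2 * k ∧ c ≤ 2 * k ∧ v = cosz k a b c} := by
  set S := Submodule.span ℂ
        {v : ↥(W k) ⊗[ℂ] ↥(V k 2) |
          ∃ a b c : ℕ, a ≤ 2 * k ∧ b ≤ 2 * k ∧ c ≤ 2 * k ∧ v = cosz k a b c} with hS
  apply le_antisymm
  · obtain ⟨Q, _, _, π, hπ⟩ := exists_linearMap_ker_eq S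
    have hF : PairwiseAffine k (fun a b c => π (xW k a ⊗ₜ[ℂ] xV2 k b c))
        (fun a m => π (xW k a ⊗ₜ[ℂ] epsV2 k m)) := by
      refine ⟨fun {a b c} _ hb hc => ?_, fun {a b c} ha hb hc => ?_,
        fun {a b c b' c'} _ hb hc hb' hc' hs => ?_⟩
      · have : xV2 k b c = xV2 k c b := by
          apply Subtype.ext
          rw [coe_xV2 hb hc, coe_xV2 hc hb, mul_comm]
        simp only [this]
      · have : cosz k b a c ∈ LinearMap.ker π := by
          rw [hπ]
          exact Submodule.subset_span ⟨b, a, c, hb, ha, hc, rfl⟩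
        rwa [LinearMap.mem_ker, cosz, map_sub, sub_eq_zero] at this
      · rw [← map_sub, ← TensorProduct.tmul_sub, xV2_sub_xV2 hb hc hb' hc' hs,
          TensorProduct.tmul_smul, map_smul]
    obtain ⟨α, β, hαβ⟩ := hF.exists_affine
    have hlift : (liftA k α β).comp (f1 k) = π := by
      refine tensor_hom_ext fun a b c ha hb hc => ?_
      rw [hαβ a b c ha hb hc, LinearMap.comp_apply, f1_tmul, coe_xW ha, coe_xV2 hb hc,
        x_mul_x_mul_x, liftA_ribbonMonomial]
      omega
    intro z hz
    rw [← hπ, ← hlift, LinearMap.mem_ker, LinearMap.comp_apply, LinearMap.mem_ker.mp hz,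
      map_zero]
  · rw [hS, Submodule.span_le]
    rintro _ ⟨a, b, c, ha, hb, hc, rfl⟩
    rw [SetLike.mem_coe, LinearMap.mem_ker, cosz, map_sub, f1_tmul, f1_tmul, coe_xW ha, coe_xW hb,
      coe_xV2 ha hc, coe_xV2 hb hc]
    ring
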